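/- arXiv:2605.09110 — 8 statements merged into one kernel-verified Lean document; each statement's English description precedes it below -/
import Mathlib

section
/- Let K be a field and a, b ∈ K. The set of nonzero elements of K represented by the 2-fold Pfister form ⟨⟨a,b⟩⟩ is a subgroup of K×: if s ≠ 0 and t ≠ 0 are both of the form x² − a·y² − b·z² + a·b·w², then so are the product s·t and the inverse s⁻¹. -/
/-- The nonzero values of the 2-fold Pfister form `⟨⟨a,b⟩⟩` over a field form a subgroup of
`K×`: they are closed under products and inverses. -/
theorem pfister2_values_subgroup
    (K : Type*) [Field K] (a b : K) (s t : K) (hs : s ≠ 0) (ht : t ≠ 0)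
    (hsrep : ∃ x y z w : K, s = x ^ 2 - a * y ^ 2 - b * z ^ 2 + a * b * w ^ 2)
    (htrep : ∃ x y z w : K, t = x ^ 2 - a * y ^ 2 - b * z ^ 2 + a * b * w ^ 2) :
    (∃ x y z w : K, s * t = x ^ 2 - a * y ^ 2 - b * z ^ 2 + a * b * w ^ 2) ∧
      (∃ x y z w : K, s⁻¹ = x ^ 2 - a * y ^ 2 - b * z ^ 2 + a * b * w ^ 2) := by
  obtain ⟨x, y, z, w, h⟩ := hsrep
  obtain ⟨X, Y, Z, W, h'⟩ := htrep
  constructor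
  · refine ⟨x * X + a * y * Y + b * z * Z - a * b * w * W,
      x * Y + y * X - b * z * W + b * w * Z,
      x * Z + z * X + a * y * W - a * w * Y,
      x * W + w * X + y * Z - z * Y, ?_⟩
    rw [h, h']
    ring
  · refine ⟨x * s⁻¹, y * s⁻¹, z * s⁻¹, w * s⁻¹, ?_⟩
    have e : s⁻¹ = s * (s⁻¹) ^ 2 := by field_simp
    calc s⁻¹ = s * (s⁻¹) ^ 2 := e
      _ = (x ^ 2 - a * y ^ 2 - b * z ^ 2 + a * b * w ^ 2) * (s⁻¹) ^ 2 :=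
        congrArg (fun r => r * (s⁻¹) ^ 2) h
      _ = _ := by ring
end

section
/- Let K be a field of characteristic different from 2 and let a, b, c ∈ K be nonzero. Assume that −1 is represented by the 2-fold Pfister form ⟨⟨a,b⟩⟩ and that the 3-fold Pfister form ⟨⟨a,b,c⟩⟩ is anisotropic over K. Then: (i) there exist nonzero n₁, n₂ ∈ K with c = n₁·n₂ such that n₁ is represented by ⟨⟨a,b⟩⟩ and n₂ is represented by ⟨⟨−ac, b⟩⟩; (ii) there exist x, y ∈ K with c = x² + c·y² (i.e. c is a norm from K(√−c)); (iii) c is not represented by ⟨⟨a,b⟩⟩; and (iv) c is not represented by ⟨⟨−ac, b⟩⟩. -/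
/-- Let `a, b, c ≠ 0` in a field `K` of characteristic ≠ 2, with `-1` represented by the
2-fold Pfister form `⟨⟨a,b⟩⟩` and `⟨⟨a,b,c⟩⟩` anisotropic. Then `c` factors as a product of
a nonzero value of `⟨⟨a,b⟩⟩` and a nonzero value of `⟨⟨-ac,b⟩⟩`, `c` is a norm from
`K(√-c)`, and `c` is represented by neither `⟨⟨a,b⟩⟩` nor `⟨⟨-ac,b⟩⟩`. -/
theorem pfister3_anisotropic_example
    (K : Type*) [Field K] (hK : (2 : K) ≠ 0) (a b c : K)
    (ha : a ≠ 0) (hb : b ≠ 0) (hc : c ≠ 0)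
    (hneg : ∃ x y z w : K, x ^ 2 - a * y ^ 2 - b * z ^ 2 + a * b * w ^ 2 = -1)
    (haniso : ∀ x₁ x₂ x₃ x₄ x₅ x₆ x₇ x₈ : K,
      x₁ ^ 2 - a * x₂ ^ 2 - b * x₃ ^ 2 + a * b * x₄ ^ 2
        - c * x₅ ^ 2 + a * c * x₆ ^ 2 + b * c * x₇ ^ 2 - a * b * c * x₈ ^ 2 = 0 →
      x₁ = 0 ∧ x₂ = 0 ∧ x₃ = 0 ∧ x₄ = 0 ∧ x₅ = 0 ∧ x₆ = 0 ∧ x₇ = 0 ∧ x₈ = 0) :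
    (∃ n₁ n₂ : K, n₁ ≠ 0 ∧ n₂ ≠ 0 ∧ c = n₁ * n₂ ∧
        (∃ x y z w : K, n₁ = x ^ 2 - a * y ^ 2 - b * z ^ 2 + a * b * w ^ 2) ∧
        (∃ x y z w : K, n₂ = x ^ 2 + a * c * y ^ 2 - b * z ^ 2 - a * b * c * w ^ 2)) ∧
      (∃ x y : K, c = x ^ 2 + c * y ^ 2) ∧
      (¬∃ x y z w : K, c = x ^ 2 - a * y ^ 2 - b * z ^ 2 + a * b * w ^ 2) ∧
      (¬∃ x y z w : K, c = x ^ 2 + a * c * y ^ 2 - b * z ^ 2 - a * b * c * w ^ 2) := by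
  obtain ⟨x, y, z, w, h⟩ := hneg
  refine ⟨⟨a⁻¹, a * c, inv_ne_zero ha, mul_ne_zero ha hc, by field_simp,
    ⟨y, x / a, w, z / a, ?_⟩, ⟨0, 1, 0, 0, by ring⟩⟩, ⟨0, 1, by ring⟩, ?_, ?_⟩
  · field_simp
    linear_combination h
  · rintro ⟨x, y, z, w, h⟩
    have := haniso x y z w 1 0 0 0 (by linear_combination -h)
    exact one_ne_zero this.2.2.2.2.1
  · rintro ⟨x, y, z, w, h⟩
    have := haniso x 0 z 0 1 y 0 w (by linear_combination -h)
    exact one_ne_zero this.2.2.2.2.1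
end

section
/- Let K be a field, Γ₀ a linearly ordered commutative group with zero, and v : K → Γ₀ a valuation on K. Let a, b ∈ K with v(a) = 1, v(b) = 1 and v(2) = 1 (so a, b, 2 are units of the valuation ring O of v). Assume that the residue form x² − ā·y² − b̄·z² + ā·b̄·w² is anisotropic over the residue field of O, where ā, b̄ denote the residues of a and b. If t ∈ K is nonzero and v(t) is not a square in the value group, i.e. v(t) ≠ v(s)² for every nonzero s ∈ K, then t is not represented over K by the 2-fold Pfister form ⟨⟨a,b⟩⟩. -/
/-- Let `v` be a valuation on a field `K`, and `a, b, 2` units of the valuation ring whose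
residue 2-fold Pfister form is anisotropic over the residue field. If `t ≠ 0` and `v t` is
not a square in the value group, then `t` is not represented by `⟨⟨a,b⟩⟩` over `K`. -/
theorem pfister2_not_represents_of_odd_valuation
    (K : Type*) [Field K] (Γ₀ : Type*) [LinearOrderedCommGroupWithZero Γ₀]
    (v : Valuation K Γ₀) (a b : K)
    (hva : v a = 1) (hvb : v b = 1) (hv2 : v 2 = 1)
    (hres : ∀ x y z w : IsLocalRing.ResidueField v.valuationSubring,
      x ^ 2 - IsLocalRing.residue _ (⟨a, hva.le⟩ : v.valuationSubring) * y ^ 2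
        - IsLocalRing.residue _ (⟨b, hvb.le⟩ : v.valuationSubring) * z ^ 2
        + IsLocalRing.residue _ (⟨a, hva.le⟩ : v.valuationSubring)
          * IsLocalRing.residue _ (⟨b, hvb.le⟩ : v.valuationSubring) * w ^ 2 = 0 →
      x = 0 ∧ y = 0 ∧ z = 0 ∧ w = 0)
    (t : K) (ht : t ≠ 0) (htv : ∀ s : K, s ≠ 0 → v t ≠ (v s) ^ 2) :
    ¬∃ x y z w : K, t = x ^ 2 - a * y ^ 2 - b * z ^ 2 + a * b * w ^ 2 := by
  rintro ⟨x, y, z, w, h⟩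
  -- `s` is a coordinate of maximal valuation
  have key : ∀ s : K, v x ≤ v s → v y ≤ v s → v z ≤ v s → v w ≤ v s →
      (s = x ∨ s = y ∨ s = z ∨ s = w) → False := by
    intro s hx hy hz hw hs
    have hs0 : s ≠ 0 := by
      rintro rfl
      simp only [map_zero, le_zero_iff, map_eq_zero] at hx hy hz hw
      subst hx hy hz hw
      exact ht (by rw [h]; ring)
    have hvs : v s ≠ 0 := (Valuation.ne_zero_iff v).2 hs0
    have hdiv : ∀ r : K, v r ≤ v s → v (r / s) ≤ 1 := by
      intro r hr
      rw [map_div₀]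
      exact div_le_one_of_le₀ hr zero_le'
    let A : v.valuationSubring := ⟨a, hva.le⟩
    let B : v.valuationSubring := ⟨b, hvb.le⟩
    let X : v.valuationSubring := ⟨x / s, hdiv x hx⟩
    let Y : v.valuationSubring := ⟨y / s, hdiv y hy⟩
    let Z : v.valuationSubring := ⟨z / s, hdiv z hz⟩
    let W : v.valuationSubring := ⟨w / s, hdiv w hw⟩
    let T : v.valuationSubring := X ^ 2 - A * Y ^ 2 - B * Z ^ 2 + A * B * W ^ 2
    have hT : (T : K) = t / s ^ 2 := by
      change (x / s) ^ 2 - a * (y / s) ^ 2 - b * (z / s) ^ 2 + a * b * (w / s) ^ 2 = t / s ^ 2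
      rw [h]
      field_simp
    have hTres : IsLocalRing.residue _ T = 0 := by
      rw [IsLocalRing.residue_eq_zero_iff, IsLocalRing.mem_maximalIdeal, mem_nonunits_iff]
      intro hu
      obtain ⟨U, hU⟩ := hu.exists_right_inv
      have hle : v (T : K) ≤ 1 := T.2
      have hle' : v (U : K) ≤ 1 := U.2
      have hmul : v (T : K) * v (U : K) = 1 := by
        rw [← map_mul, ← map_one v]
        exact congrArg (fun r : v.valuationSubring => v (r : K)) hU
      have h1 : v (T : K) = 1 := by
        refine le_antisymm hle ?_
        calc (1 : Γ₀) = v (T : K) * v (U : K) := hmul.symm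
          _ ≤ v (T : K) := mul_le_of_le_one_right' hle'
      rw [hT, map_div₀, map_pow] at h1
      exact htv s hs0 ((div_eq_one_iff_eq (pow_ne_zero 2 hvs)).1 h1)
    have hall := hres (IsLocalRing.residue _ X) (IsLocalRing.residue _ Y)
      (IsLocalRing.residue _ Z) (IsLocalRing.residue _ W)
      (by simpa only [T, map_add, map_sub, map_mul, map_pow] using hTres)
    obtain ⟨eX, eY, eZ, eW⟩ := hall
    have hone : ∀ R : v.valuationSubring, (R : K) = s / s → IsLocalRing.residue _ R = 0 → False := by
      intro R hR h0
      have : R = 1 := Subtype.ext (by rw [hR, div_self hs0]; rfl)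
      rw [this, map_one] at h0
      exact one_ne_zero h0
    rcases hs with e | e | e | e
    · exact hone X (by simp only [X, e]) eX
    · exact hone Y (by simp only [Y, e]) eY
    · exact hone Z (by simp only [Z, e]) eZ
    · exact hone W (by simp only [W, e]) eW
  have k1 := key x
  have k2 := key y
  have k3 := key z
  have k4 := key w
  simp only [true_or, or_true, le_refl, forall_const] at k1 k2 k3 k4
  rcases le_total (v x) (v y) with h1 | h1 <;> rcases le_total (v z) (v w) with h2 | h2
  · rcases le_total (v y) (v w) with h3 | h3
    · exact k4 (h1.trans h3) h3 h2
    · exact k2 h1 (h2.trans h3) h3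
  · rcases le_total (v y) (v z) with h3 | h3
    · exact k3 (h1.trans h3) h3 h2
    · exact k2 h1 h3 (h2.trans h3)
  · rcases le_total (v x) (v w) with h3 | h3
    · exact k4 h3 (h1.trans h3) h2
    · exact k1 h1 (h2.trans h3) h3
  · rcases le_total (v x) (v z) with h3 | h3
    · exact k3 h3 (h1.trans h3) h2
    · exact k1 h1 h3 (h2.trans h3)
end

section
/- Let K be a field, Γ₀ a linearly ordered commutative group with zero, and v : K → Γ₀ a valuation on K. Let a, b ∈ K with v(a) = 1, v(b) = 1 and v(2) = 1. If the residue form x² − ā·y² − b̄·z² + ā·b̄·w² is anisotropic over the residue field of the valuation ring of v (where ā, b̄ are the residues of a and b), then the 2-fold Pfister form ⟨⟨a,b⟩⟩ is anisotropic over K. -/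
/-- Let `v` be a valuation on a field `K`, and `a, b, 2` units of the valuation ring. If the
residue 2-fold Pfister form is anisotropic over the residue field, then the 2-fold Pfister
form `⟨⟨a,b⟩⟩` is anisotropic over `K`. -/
theorem pfister2_anisotropic_of_residue_anisotropic
    (K : Type*) [Field K] (Γ₀ : Type*) [LinearOrderedCommGroupWithZero Γ₀]
    (v : Valuation K Γ₀) (a b : K)
    (hva : v a = 1) (hvb : v b = 1) (hv2 : v 2 = 1)
    (hres : ∀ x y z w : IsLocalRing.ResidueField v.valuationSubring,
      x ^ 2 - IsLocalRing.residue _ (⟨a, hva.le⟩ : v.valuationSubring) * y ^ 2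
        - IsLocalRing.residue _ (⟨b, hvb.le⟩ : v.valuationSubring) * z ^ 2
        + IsLocalRing.residue _ (⟨a, hva.le⟩ : v.valuationSubring)
          * IsLocalRing.residue _ (⟨b, hvb.le⟩ : v.valuationSubring) * w ^ 2 = 0 →
      x = 0 ∧ y = 0 ∧ z = 0 ∧ w = 0) :
    ∀ x y z w : K, x ^ 2 - a * y ^ 2 - b * z ^ 2 + a * b * w ^ 2 = 0 →
      x = 0 ∧ y = 0 ∧ z = 0 ∧ w = 0 := by
  intro x y z w h
  have key : ∀ m : K, m ≠ 0 → v x ≤ v m → v y ≤ v m → v z ≤ v m → v w ≤ v m →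
      x ≠ m ∧ y ≠ m ∧ z ≠ m ∧ w ≠ m := by
    intro m hm hx hy hz hw
    have hvm : v m ≠ 0 := (Valuation.ne_zero_iff v).2 hm
    have hd : ∀ t : K, v t ≤ v m → v (t / m) ≤ 1 := by
      intro t ht
      rw [map_div₀]
      exact div_le_one_of_le₀ ht zero_le
    have hne : ∀ (t : K) (ht : v t ≤ v m),
        IsLocalRing.residue _ (⟨t / m, hd t ht⟩ : v.valuationSubring) = 0 → t ≠ m := by
      intro t ht h0 htm
      subst htm
      have h1 : (⟨t / t, hd t ht⟩ : v.valuationSubring) = 1 := Subtype.ext (div_self hm)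
      rw [h1, map_one] at h0
      exact one_ne_zero h0
    have hO : (⟨x / m, hd x hx⟩ : v.valuationSubring) ^ 2
        - ⟨a, hva.le⟩ * (⟨y / m, hd y hy⟩ : v.valuationSubring) ^ 2
        - ⟨b, hvb.le⟩ * (⟨z / m, hd z hz⟩ : v.valuationSubring) ^ 2
        + ⟨a, hva.le⟩ * ⟨b, hvb.le⟩ * (⟨w / m, hd w hw⟩ : v.valuationSubring) ^ 2 = 0 := by
      apply Subtype.ext
      change (x / m) ^ 2 - a * (y / m) ^ 2 - b * (z / m) ^ 2 + a * b * (w / m) ^ 2 = 0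
      have : (x / m) ^ 2 - a * (y / m) ^ 2 - b * (z / m) ^ 2 + a * b * (w / m) ^ 2
        = (x ^ 2 - a * y ^ 2 - b * z ^ 2 + a * b * w ^ 2) / m ^ 2 := by ring
      rw [this, h, zero_div]
    have hR := congrArg (IsLocalRing.residue v.valuationSubring) hO
    simp only [map_add, map_sub, map_mul, map_pow, map_zero] at hR
    obtain ⟨h1, h2, h3, h4⟩ := hres _ _ _ _ hR
    exact ⟨hne x hx h1, hne y hy h2, hne z hz h3, hne w hw h4⟩
  obtain ⟨m, hmem, hmax⟩ : ∃ m : K, (x = m ∨ y = m ∨ z = m ∨ w = m) ∧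
      (v x ≤ v m ∧ v y ≤ v m ∧ v z ≤ v m ∧ v w ≤ v m) := by
    classical
    obtain ⟨m, hm, hM⟩ := Finset.exists_max_image ({x, y, z, w} : Finset K) v ⟨x, by simp⟩
    refine ⟨m, ?_, hM x (by simp), hM y (by simp), hM z (by simp), hM w (by simp)⟩
    simp only [Finset.mem_insert, Finset.mem_singleton] at hm
    tauto
  obtain ⟨hx, hy, hz, hw⟩ := hmax
  by_cases hm : m = 0
  · subst hm
    simp only [map_zero, le_zero_iff, map_eq_zero] at hx hy hz hw
    exact ⟨hx, hy, hz, hw⟩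
  · have := key m hm hx hy hz hw
    tauto
end

section
/- Let K be a field, Γ₀ a linearly ordered commutative group with zero, and v : K → Γ₀ a valuation on K. Let a, b ∈ K with v(a) = 1, v(b) = 1 and v(2) = 1, and assume the residue form x² − ā·y² − b̄·z² + ā·b̄·w² is anisotropic over the residue field of the valuation ring of v. Let t ∈ K be nonzero with v(t) ≠ v(s)² for every nonzero s ∈ K. Then the 3-fold Pfister form ⟨⟨a,b,t⟩⟩ is anisotropic over K. -/
/-- The 2-fold Pfister form has value `1` on integral vectors with a unit coordinate. -/
theorem pfister2_val_one
    {K : Type*} [Field K] {Γ₀ : Type*} [LinearOrderedCommGroupWithZero Γ₀]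
    (v : Valuation K Γ₀) (a b : K) (hva : v a = 1) (hvb : v b = 1)
    (hres : ∀ x y z w : IsLocalRing.ResidueField v.valuationSubring,
      x ^ 2 - IsLocalRing.residue _ (⟨a, hva.le⟩ : v.valuationSubring) * y ^ 2
        - IsLocalRing.residue _ (⟨b, hvb.le⟩ : v.valuationSubring) * z ^ 2
        + IsLocalRing.residue _ (⟨a, hva.le⟩ : v.valuationSubring)
          * IsLocalRing.residue _ (⟨b, hvb.le⟩ : v.valuationSubring) * w ^ 2 = 0 →
      x = 0 ∧ y = 0 ∧ z = 0 ∧ w = 0)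
    (x y z w : K) (hx : v x ≤ 1) (hy : v y ≤ 1) (hz : v z ≤ 1) (hw : v w ≤ 1)
    (h1 : v x = 1 ∨ v y = 1 ∨ v z = 1 ∨ v w = 1) :
    v (x ^ 2 - a * y ^ 2 - b * z ^ 2 + a * b * w ^ 2) = 1 := by
  have key : ∀ u : v.valuationSubring, IsLocalRing.residue _ u = 0 ↔ v (u : K) ≠ 1 := by
    intro u
    rw [IsLocalRing.residue_eq_zero_iff, IsLocalRing.mem_maximalIdeal, mem_nonunits_iff]
    apply not_congr
    constructor
    · rintro hu
      obtain ⟨c, hc⟩ := hu.exists_right_inv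
      have hc' : (u : K) * (c : K) = 1 := by exact_mod_cast congrArg Subtype.val hc
      have h := congrArg v hc'
      rw [map_mul, map_one] at h
      have hu1 : v (u : K) ≤ 1 := u.2
      have hc1 : v (c : K) ≤ 1 := c.2
      apply le_antisymm hu1
      calc (1 : Γ₀) = v (u : K) * v (c : K) := h.symm
        _ ≤ v (u : K) * 1 := by gcongr
        _ = v (u : K) := mul_one _
    · intro hu
      have hne : (u : K) ≠ 0 := by
        intro h0
        rw [h0, map_zero] at hu
        exact zero_ne_one hu
      have hi : v ((u : K)⁻¹) ≤ 1 := by rw [map_inv₀, hu, inv_one]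
      refine IsUnit.of_mul_eq_one (⟨(u : K)⁻¹, hi⟩ : v.valuationSubring) ?_
      exact Subtype.ext (mul_inv_cancel₀ hne)
  let A : v.valuationSubring := ⟨a, hva.le⟩
  let B : v.valuationSubring := ⟨b, hvb.le⟩
  let X : v.valuationSubring := ⟨x, hx⟩
  let Y : v.valuationSubring := ⟨y, hy⟩
  let Z : v.valuationSubring := ⟨z, hz⟩
  let W : v.valuationSubring := ⟨w, hw⟩
  by_contra hne
  have h0 := (key (X ^ 2 - A * Y ^ 2 - B * Z ^ 2 + A * B * W ^ 2)).2 hne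
  simp only [map_add, map_sub, map_mul, map_pow] at h0
  obtain ⟨ex, ey, ez, ew⟩ := hres _ _ _ _ h0
  have ex' : v x ≠ 1 := (key X).1 ex
  have ey' : v y ≠ 1 := (key Y).1 ey
  have ez' : v z ≠ 1 := (key Z).1 ez
  have ew' : v w ≠ 1 := (key W).1 ew
  tauto

/-- The 2-fold Pfister form takes values of square valuation on nonzero vectors. -/
theorem pfister2_val_sq
    {K : Type*} [Field K] {Γ₀ : Type*} [LinearOrderedCommGroupWithZero Γ₀]
    (v : Valuation K Γ₀) (a b : K) (hva : v a = 1) (hvb : v b = 1)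
    (hres : ∀ x y z w : IsLocalRing.ResidueField v.valuationSubring,
      x ^ 2 - IsLocalRing.residue _ (⟨a, hva.le⟩ : v.valuationSubring) * y ^ 2
        - IsLocalRing.residue _ (⟨b, hvb.le⟩ : v.valuationSubring) * z ^ 2
        + IsLocalRing.residue _ (⟨a, hva.le⟩ : v.valuationSubring)
          * IsLocalRing.residue _ (⟨b, hvb.le⟩ : v.valuationSubring) * w ^ 2 = 0 →
      x = 0 ∧ y = 0 ∧ z = 0 ∧ w = 0)
    (x y z w : K) (h : ¬ (x = 0 ∧ y = 0 ∧ z = 0 ∧ w = 0)) :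
    ∃ m : K, m ≠ 0 ∧ v (x ^ 2 - a * y ^ 2 - b * z ^ 2 + a * b * w ^ 2) = v m ^ 2 := by
  obtain ⟨m, hm, hx, hy, hz, hw⟩ : ∃ m : K, (m = x ∨ m = y ∨ m = z ∨ m = w) ∧
      v x ≤ v m ∧ v y ≤ v m ∧ v z ≤ v m ∧ v w ≤ v m := by
    obtain ⟨i, hi⟩ := Finite.exists_max (fun i : Fin 4 => v (![x, y, z, w] i))
    refine ⟨![x, y, z, w] i, ?_, hi 0, hi 1, hi 2, hi 3⟩
    fin_cases i <;> simp
  have hm0 : m ≠ 0 := by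
    rintro rfl
    simp only [map_zero, le_zero_iff, map_eq_zero] at hx hy hz hw
    exact h ⟨hx, hy, hz, hw⟩
  have hvm : v m ≠ 0 := (map_ne_zero v).2 hm0
  have hd : ∀ u : K, v u ≤ v m → v (u / m) ≤ 1 := by
    intro u hu
    rw [map_div₀]
    exact div_le_one_of_le₀ hu zero_le
  have h1 := pfister2_val_one v a b hva hvb hres (x / m) (y / m) (z / m) (w / m)
    (hd x hx) (hd y hy) (hd z hz) (hd w hw) (by
      have : v (m / m) = 1 := by rw [div_self hm0, map_one]
      rcases hm with e | e | e | e
      · left; rw [← e]; exact this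
      · right; left; rw [← e]; exact this
      · right; right; left; rw [← e]; exact this
      · right; right; right; rw [← e]; exact this)
  refine ⟨m, hm0, ?_⟩
  have e : x ^ 2 - a * y ^ 2 - b * z ^ 2 + a * b * w ^ 2 =
      ((x / m) ^ 2 - a * (y / m) ^ 2 - b * (z / m) ^ 2 + a * b * (w / m) ^ 2) * m ^ 2 := by
    field_simp
  rw [e, map_mul, h1, one_mul, map_pow]

/-- Let `v` be a valuation on a field `K`, `a, b, 2` units of the valuation ring with
anisotropic residue 2-fold Pfister form, and `t ≠ 0` with `v t` not a square in the value
group. Then the 3-fold Pfister form `⟨⟨a,b,t⟩⟩` is anisotropic over `K`. -/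
theorem pfister3_anisotropic_of_residue_anisotropic
    (K : Type*) [Field K] (Γ₀ : Type*) [LinearOrderedCommGroupWithZero Γ₀]
    (v : Valuation K Γ₀) (a b : K)
    (hva : v a = 1) (hvb : v b = 1) (hv2 : v 2 = 1)
    (hres : ∀ x y z w : IsLocalRing.ResidueField v.valuationSubring,
      x ^ 2 - IsLocalRing.residue _ (⟨a, hva.le⟩ : v.valuationSubring) * y ^ 2
        - IsLocalRing.residue _ (⟨b, hvb.le⟩ : v.valuationSubring) * z ^ 2
        + IsLocalRing.residue _ (⟨a, hva.le⟩ : v.valuationSubring)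
          * IsLocalRing.residue _ (⟨b, hvb.le⟩ : v.valuationSubring) * w ^ 2 = 0 →
      x = 0 ∧ y = 0 ∧ z = 0 ∧ w = 0)
    (t : K) (ht : t ≠ 0) (htv : ∀ s : K, s ≠ 0 → v t ≠ (v s) ^ 2) :
    ∀ x₁ x₂ x₃ x₄ x₅ x₆ x₇ x₈ : K,
      x₁ ^ 2 - a * x₂ ^ 2 - b * x₃ ^ 2 + a * b * x₄ ^ 2
        - t * x₅ ^ 2 + a * t * x₆ ^ 2 + b * t * x₇ ^ 2 - a * b * t * x₈ ^ 2 = 0 →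
      x₁ = 0 ∧ x₂ = 0 ∧ x₃ = 0 ∧ x₄ = 0 ∧ x₅ = 0 ∧ x₆ = 0 ∧ x₇ = 0 ∧ x₈ = 0 := by
  intro x₁ x₂ x₃ x₄ x₅ x₆ x₇ x₈ h
  have hq := pfister2_val_sq v a b hva hvb hres
  have e : x₁ ^ 2 - a * x₂ ^ 2 - b * x₃ ^ 2 + a * b * x₄ ^ 2 =
      t * (x₅ ^ 2 - a * x₆ ^ 2 - b * x₇ ^ 2 + a * b * x₈ ^ 2) := by
    linear_combination h
  have e' := congrArg v e
  rw [map_mul] at e'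
  by_cases h2 : x₅ = 0 ∧ x₆ = 0 ∧ x₇ = 0 ∧ x₈ = 0
  · by_cases h1 : x₁ = 0 ∧ x₂ = 0 ∧ x₃ = 0 ∧ x₄ = 0
    · tauto
    · exfalso
      obtain ⟨n, hn, hn'⟩ := hq _ _ _ _ h1
      obtain ⟨rfl, rfl, rfl, rfl⟩ := h2
      rw [hn'] at e'
      simp [hn] at e'
  · exfalso
    obtain ⟨m, hm, hm'⟩ := hq _ _ _ _ h2
    have hvm : v m ≠ 0 := (map_ne_zero v).2 hm
    rw [hm'] at e'
    by_cases h1 : x₁ = 0 ∧ x₂ = 0 ∧ x₃ = 0 ∧ x₄ = 0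
    · obtain ⟨rfl, rfl, rfl, rfl⟩ := h1
      simp [hm, ht] at e'
    · obtain ⟨n, hn, hn'⟩ := hq _ _ _ _ h1
      rw [hn'] at e'
      apply htv (n / m) (div_ne_zero hn hm)
      rw [map_div₀, div_pow, e', mul_div_cancel_right₀ _ (pow_ne_zero 2 hvm)]
end

section
/- Let K be a field, Γ₀ a linearly ordered commutative group with zero, and v : K → Γ₀ a valuation on K. Let a, b, t ∈ K with v(a) = 1, v(b) = 1, v(2) = 1, t ≠ 0, and v(t) ≠ v(s)² for every nonzero s ∈ K. Assume that a is a sum of two squares in K and that the residue form x² − ā·y² − b̄·z² + ā·b̄·w² is anisotropic over the residue field of the valuation ring of v. Then: (i) there exist nonzero n₁, n₂ ∈ K with t = n₁·n₂ such that n₁ is represented by the 2-fold Pfister form ⟨⟨a,b⟩⟩ and n₂ is represented by ⟨⟨−at, b⟩⟩; (ii) there exist x, y ∈ K with t = x² + t·y² (i.e. t is a norm from K(√−t)); (iii) t is not represented by ⟨⟨a,b⟩⟩; and (iv) t is not represented by ⟨⟨−at, b⟩⟩. -/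
/-- Let `v` be a valuation on a field `K`, `a, b, 2` units of the valuation ring with
anisotropic residue 2-fold Pfister form, `a` a sum of two squares in `K`, and `t ≠ 0` with
`v t` not a square in the value group. Then `t` factors as a product of a nonzero value
of `⟨⟨a,b⟩⟩` and a nonzero value of `⟨⟨-at,b⟩⟩`, `t` is a norm from `K(√-t)`, and `t` is
represented by neither `⟨⟨a,b⟩⟩` nor `⟨⟨-at,b⟩⟩`. -/
theorem valuation_pfister_example
    (K : Type*) [Field K] (Γ₀ : Type*) [LinearOrderedCommGroupWithZero Γ₀]
    (v : Valuation K Γ₀) (a b t : K)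
    (hva : v a = 1) (hvb : v b = 1) (hv2 : v 2 = 1)
    (ht : t ≠ 0) (htv : ∀ s : K, s ≠ 0 → v t ≠ (v s) ^ 2)
    (hsum : ∃ s₁ s₂ : K, a = s₁ ^ 2 + s₂ ^ 2)
    (hres : ∀ x y z w : IsLocalRing.ResidueField v.valuationSubring,
      x ^ 2 - IsLocalRing.residue _ (⟨a, hva.le⟩ : v.valuationSubring) * y ^ 2
        - IsLocalRing.residue _ (⟨b, hvb.le⟩ : v.valuationSubring) * z ^ 2
        + IsLocalRing.residue _ (⟨a, hva.le⟩ : v.valuationSubring)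
          * IsLocalRing.residue _ (⟨b, hvb.le⟩ : v.valuationSubring) * w ^ 2 = 0 →
      x = 0 ∧ y = 0 ∧ z = 0 ∧ w = 0) :
    (∃ n₁ n₂ : K, n₁ ≠ 0 ∧ n₂ ≠ 0 ∧ t = n₁ * n₂ ∧
        (∃ x y z w : K, n₁ = x ^ 2 - a * y ^ 2 - b * z ^ 2 + a * b * w ^ 2) ∧
        (∃ x y z w : K, n₂ = x ^ 2 + a * t * y ^ 2 - b * z ^ 2 - a * b * t * w ^ 2)) ∧
      (∃ x y : K, t = x ^ 2 + t * y ^ 2) ∧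
      (¬∃ x y z w : K, t = x ^ 2 - a * y ^ 2 - b * z ^ 2 + a * b * w ^ 2) ∧
      (¬∃ x y z w : K, t = x ^ 2 + a * t * y ^ 2 - b * z ^ 2 - a * b * t * w ^ 2) := by
  have hA : ∀ x y z w : K, v x ≤ 1 → v y ≤ 1 → v z ≤ 1 → v w ≤ 1 →
      v (x ^ 2 - a * y ^ 2 - b * z ^ 2 + a * b * w ^ 2) < 1 →
      v x < 1 ∧ v y < 1 ∧ v z < 1 ∧ v w < 1 := by
    intro x y z w hx hy hz hw hq
    have key : ∀ u : v.valuationSubring, IsLocalRing.residue _ u = 0 ↔ v (u : K) < 1 := by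
      intro u
      rw [IsLocalRing.residue_eq_zero_iff]
      have h1 := v.valuationSubring.valuation_lt_one_iff u
      rw [h1]
      exact (Valuation.isEquiv_valuation_valuationSubring v).lt_one_iff_lt_one.symm
    let X : v.valuationSubring := ⟨x, hx⟩
    let Y : v.valuationSubring := ⟨y, hy⟩
    let Z : v.valuationSubring := ⟨z, hz⟩
    let W : v.valuationSubring := ⟨w, hw⟩
    let A : v.valuationSubring := ⟨a, hva.le⟩
    let B : v.valuationSubring := ⟨b, hvb.le⟩
    have h0 := (key (X ^ 2 - A * Y ^ 2 - B * Z ^ 2 + A * B * W ^ 2)).2 hq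
    simp only [map_add, map_sub, map_mul, map_pow] at h0
    obtain ⟨h1, h2, h3, h4⟩ := hres _ _ _ _ h0
    exact ⟨(key X).1 h1, (key Y).1 h2, (key Z).1 h3, (key W).1 h4⟩
  have hB : ∀ s x y z w : K, v x ≤ v s → v y ≤ v s → v z ≤ v s → v w ≤ v s →
      (s = x ∨ s = y ∨ s = z ∨ s = w) →
      v (x ^ 2 - a * y ^ 2 - b * z ^ 2 + a * b * w ^ 2) = v s ^ 2 := by
    intro s x y z w hx hy hz hw hs
    by_cases hs0 : s = 0
    · subst hs0
      simp only [map_zero, le_zero_iff, map_eq_zero] at hx hy hz hw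
      subst hx hy hz hw
      simp
    have hvs : v s ≠ 0 := by simpa using hs0
    have hdiv : ∀ u : K, v u ≤ v s → v (u / s) ≤ 1 := by
      intro u hu
      rw [map_div₀]
      exact div_le_one_of_le₀ hu zero_le'
    have hself : v (s / s) = 1 := by rw [div_self hs0, map_one]
    have h1 : ¬ v ((x/s) ^ 2 - a * (y/s) ^ 2 - b * (z/s) ^ 2 + a * b * (w/s) ^ 2) < 1 := by
      intro hlt
      obtain ⟨k1, k2, k3, k4⟩ := hA _ _ _ _ (hdiv x hx) (hdiv y hy) (hdiv z hz) (hdiv w hw) hlt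
      rcases hs with rfl | rfl | rfl | rfl
      · exact absurd hself k1.ne
      · exact absurd hself k2.ne
      · exact absurd hself k3.ne
      · exact absurd hself k4.ne
    have h2 : v ((x/s) ^ 2 - a * (y/s) ^ 2 - b * (z/s) ^ 2 + a * b * (w/s) ^ 2) ≤ 1 := by
      have hsq : ∀ u : K, v u ≤ v s → v ((u / s) ^ 2) ≤ 1 := by
        intro u hu
        rw [map_pow]
        exact pow_le_one' (hdiv u hu) 2
      refine v.map_add_le (v.map_sub_le (v.map_sub_le (hsq x hx) ?_) ?_) ?_
      · rw [map_mul, hva, one_mul]; exact hsq y hy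
      · rw [map_mul, hvb, one_mul]; exact hsq z hz
      · rw [map_mul, map_mul, hva, hvb, one_mul, one_mul]; exact hsq w hw
    have h3 := le_antisymm h2 (not_lt.1 h1)
    have h4 : x ^ 2 - a * y ^ 2 - b * z ^ 2 + a * b * w ^ 2 =
        ((x/s) ^ 2 - a * (y/s) ^ 2 - b * (z/s) ^ 2 + a * b * (w/s) ^ 2) * s ^ 2 := by
      field_simp
    rw [h4, map_mul, h3, one_mul, map_pow]
  have hC : ∀ x y z w : K, ∃ s : K, (v x ≤ v s ∧ v y ≤ v s ∧ v z ≤ v s ∧ v w ≤ v s) ∧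
      v (x ^ 2 - a * y ^ 2 - b * z ^ 2 + a * b * w ^ 2) = v s ^ 2 := by
    intro x y z w
    obtain ⟨s, hs, h1, h2, h3, h4⟩ : ∃ s : K, (s = x ∨ s = y ∨ s = z ∨ s = w) ∧
        v x ≤ v s ∧ v y ≤ v s ∧ v z ≤ v s ∧ v w ≤ v s := by
      obtain ⟨i, hi⟩ := Finite.exists_max (fun i : Fin 4 => v (![x, y, z, w] i))
      refine ⟨![x, y, z, w] i, ?_, hi 0, hi 1, hi 2, hi 3⟩
      fin_cases i <;> simp
    exact ⟨s, ⟨h1, h2, h3, h4⟩, hB s x y z w h1 h2 h3 h4 hs⟩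
  have hvt : v t ≠ 0 := by simpa using ht
  have ha : a ≠ 0 := by rintro rfl; simp at hva
  refine ⟨?_, ⟨0, 1, by ring⟩, ?_, ?_⟩
  · obtain ⟨x, y, hxy⟩ : ∃ x y : K, a⁻¹ = x ^ 2 - a * y ^ 2 := by
      have aux : ∀ s r : K, a = s ^ 2 + r ^ 2 → s ≠ 0 → ∃ x y : K, a⁻¹ = x ^ 2 - a * y ^ 2 := by
        intro s r h hs
        refine ⟨1 / s, r / (s * a), ?_⟩
        field_simp
        linear_combination -h
      obtain ⟨s, r, h⟩ := hsum
      by_cases hs : s = 0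
      · refine aux r s (by rw [h]; ring) ?_
        rintro rfl
        apply ha
        rw [h, hs]; ring
      · exact aux s r h hs
    refine ⟨a⁻¹, a * t, inv_ne_zero ha, mul_ne_zero ha ht, by field_simp,
      ⟨x, y, 0, 0, by rw [hxy]; ring⟩, ⟨0, 1, 0, 0, by ring⟩⟩
  · rintro ⟨x, y, z, w, h⟩
    obtain ⟨s, -, hs⟩ := hC x y z w
    rw [← h] at hs
    refine htv s ?_ hs
    rintro rfl
    simp at hs
    exact ht hs
  · rintro ⟨x, y, z, w, h⟩
    obtain ⟨s, -, hs⟩ := hC x 0 z 0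
    obtain ⟨m, ⟨hm1, -⟩, hm⟩ := hC 1 y 0 w
    have hm0 : m ≠ 0 := by
      rintro rfl
      simp at hm1
    have hvm : v m ≠ 0 := by simpa using hm0
    have e : x ^ 2 - a * 0 ^ 2 - b * z ^ 2 + a * b * 0 ^ 2 =
        t * (1 ^ 2 - a * y ^ 2 - b * 0 ^ 2 + a * b * w ^ 2) := by
      linear_combination -h
    rw [e, map_mul, hm] at hs
    have hs0 : s ≠ 0 := by
      rintro rfl
      simp [ht, hm0] at hs
    refine htv (s / m) (div_ne_zero hs0 hm0) ?_
    rw [map_div₀, div_pow, ← hs]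
    exact (mul_div_cancel_right₀ _ (pow_ne_zero 2 hvm)).symm
end

section
/- Let p be an odd prime and u an integer not divisible by p whose residue class is not a square in ℤ/pℤ. Then the 2-fold Pfister form ⟨⟨p,u⟩⟩ is anisotropic over ℚ_p: for all x, y, z, w ∈ ℚ_p, if x² − p·y² − u·z² + p·u·w² = 0 then x = y = z = w = 0. -/
theorem pfister_aux_dvd (p : ℕ) [Fact p.Prime] (u : ℤ)
    (hu : ¬IsSquare (u : ZMod p)) (x z t : ℤ_[p])
    (h : x ^ 2 - (u : ℤ_[p]) * z ^ 2 = p * t) : (p : ℤ_[p]) ∣ x ∧ (p : ℤ_[p]) ∣ z := by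
  have key : ∀ a : ℤ_[p], PadicInt.toZMod a = 0 → (p : ℤ_[p]) ∣ a := by
    intro a ha
    rw [← RingHom.mem_ker, PadicInt.ker_toZMod, PadicInt.maximalIdeal_eq_span_p,
      Ideal.mem_span_singleton] at ha
    exact ha
  have h2 := congrArg (PadicInt.toZMod (p := p)) h
  simp only [map_sub, map_mul, map_pow, map_intCast, map_natCast, CharP.cast_eq_zero,
    zero_mul] at h2
  have hz : PadicInt.toZMod z = 0 := by
    by_contra hz
    apply hu
    refine ⟨PadicInt.toZMod x / PadicInt.toZMod z, ?_⟩
    field_simp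
    linear_combination -h2
  refine ⟨key x ?_, key z hz⟩
  rw [hz] at h2
  simpa using h2

theorem pfister_aux_descent (p : ℕ) [Fact p.Prime] (u : ℤ)
    (hu : ¬IsSquare (u : ZMod p)) (n : ℕ) : ∀ x y z w : ℤ_[p],
      x ^ 2 - (p : ℤ_[p]) * y ^ 2 - (u : ℤ_[p]) * z ^ 2
        + (p : ℤ_[p]) * (u : ℤ_[p]) * w ^ 2 = 0 →
      (p : ℤ_[p]) ^ n ∣ x ∧ (p : ℤ_[p]) ^ n ∣ y ∧ (p : ℤ_[p]) ^ n ∣ z ∧ (p : ℤ_[p]) ^ n ∣ w := by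
  have hp0 : (p : ℤ_[p]) ≠ 0 := by exact_mod_cast (Fact.out : p.Prime).ne_zero
  induction n with
  | zero => simp
  | succ n ih =>
    intro x y z w h
    obtain ⟨⟨x, rfl⟩, ⟨z, rfl⟩⟩ := pfister_aux_dvd p u hu x z (y ^ 2 - u * w ^ 2)
      (by linear_combination h)
    obtain ⟨⟨y, rfl⟩, ⟨w, rfl⟩⟩ := pfister_aux_dvd p u hu y w (x ^ 2 - u * z ^ 2)
      (mul_left_cancel₀ hp0 (by linear_combination -h))
    obtain ⟨h1, h2, h3, h4⟩ := ih x y z w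
      (mul_left_cancel₀ (pow_ne_zero 2 hp0) (by linear_combination h))
    simp only [pow_succ']
    exact ⟨mul_dvd_mul_left _ h1, mul_dvd_mul_left _ h2, mul_dvd_mul_left _ h3,
      mul_dvd_mul_left _ h4⟩

theorem pfister_aux_zero (p : ℕ) [Fact p.Prime] (x : ℤ_[p])
    (h : ∀ n : ℕ, (p : ℤ_[p]) ^ n ∣ x) : x = 0 := by
  by_contra hx
  obtain ⟨n, hn⟩ := FiniteMultiplicity.of_not_isUnit (PadicInt.prime_p (p := p)).not_isUnit hx
  exact hn (h _)

/-- If `p` is an odd prime and `u` an integer not divisible by `p` whose residue class is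
not a square mod `p`, then the 2-fold Pfister form `⟨⟨p,u⟩⟩` is anisotropic over `ℚ_p`. -/
theorem pfister2_p_u_anisotropic_over_padics
    (p : ℕ) [Fact p.Prime] (hp : p ≠ 2) (u : ℤ) (hpu : ¬(p : ℤ) ∣ u)
    (hu : ¬IsSquare (u : ZMod p)) :
    ∀ x y z w : ℚ_[p],
      x ^ 2 - (p : ℚ_[p]) * y ^ 2 - (u : ℚ_[p]) * z ^ 2
        + (p : ℚ_[p]) * (u : ℚ_[p]) * w ^ 2 = 0 →
      x = 0 ∧ y = 0 ∧ z = 0 ∧ w = 0 := by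
  intro x y z w h
  classical
  obtain ⟨⟨d, hd⟩, hb⟩ := IsLocalization.exist_integer_multiples_of_finset
    (nonZeroDivisors ℤ_[p]) ({x, y, z, w} : Finset ℚ_[p])
  obtain ⟨a, ha⟩ := hb x (by simp)
  obtain ⟨b, hb'⟩ := hb y (by simp)
  obtain ⟨c, hc⟩ := hb z (by simp)
  obtain ⟨e, he⟩ := hb w (by simp)
  have hd0 : (d : ℚ_[p]) ≠ 0 := by
    have := nonZeroDivisors.ne_zero hd
    exact fun h0 => this (Subtype.coe_injective h0)
  simp only [Algebra.smul_def, PadicInt.algebraMap_apply] at ha hb' hc he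
  have hE : a ^ 2 - (p : ℤ_[p]) * b ^ 2 - (u : ℤ_[p]) * c ^ 2
        + (p : ℤ_[p]) * (u : ℤ_[p]) * e ^ 2 = 0 := by
    apply Subtype.coe_injective
    push_cast
    rw [ha, hb', hc, he]
    linear_combination (d : ℚ_[p]) ^ 2 * h
  have D := fun n => pfister_aux_descent p u hu n a b c e hE
  have a0 := pfister_aux_zero p a fun n => (D n).1
  have b0 := pfister_aux_zero p b fun n => (D n).2.1
  have c0 := pfister_aux_zero p c fun n => (D n).2.2.1
  have e0 := pfister_aux_zero p e fun n => (D n).2.2.2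
  subst a0 b0 c0 e0
  have fin : ∀ t : ℚ_[p], ((0 : ℤ_[p]) : ℚ_[p]) = d * t → t = 0 := by
    intro t ht
    rw [PadicInt.coe_zero] at ht
    exact (mul_eq_zero.mp ht.symm).resolve_left hd0
  exact ⟨fin x ha, fin y hb', fin z hc, fin w he⟩
end

section
/- Let p be an odd prime and u an integer not divisible by p whose residue class is not a square in ℤ/pℤ. Let K = ℚ_p(t) be the field of rational functions in one variable t over ℚ_p. Then the 3-fold Pfister form ⟨⟨p,u,t⟩⟩, i.e. the diagonal quadratic form in eight variables over K with coefficients 1, −p, −u, pu, −t, pt, ut, −put, is anisotropic over K. -/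
theorem pf_descent {n : ℕ} {R : Type*} [CommRing R] [IsDomain R] [WfDvdMonoid R]
    (π : R) (hπ : π ≠ 0) (hu : ¬ IsUnit π) (a : Fin n → R)
    (h : ∀ x : Fin n → R, π ∣ ∑ i, a i * x i ^ 2 → ∀ i, π ∣ x i)
    (f g : Fin n → R) (e : ∑ i, a i * f i ^ 2 = π * ∑ i, a i * g i ^ 2) :
    (∀ i, f i = 0) ∧ ∀ i, g i = 0 := by
  have step : ∀ f g : Fin n → R, ∑ i, a i * f i ^ 2 = π * ∑ i, a i * g i ^ 2 →
      ∃ f' : Fin n → R, (∀ i, f i = π * f' i) ∧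
        ∑ i, a i * g i ^ 2 = π * ∑ i, a i * f' i ^ 2 := by
    intro f g e
    choose f' hf' using h f ⟨_, e⟩
    refine ⟨f', hf', ?_⟩
    apply mul_left_cancel₀ hπ
    rw [← e, Finset.mul_sum, Finset.mul_sum]
    refine Finset.sum_congr rfl fun i _ => ?_
    rw [hf' i]; ring
  have key : ∀ k : ℕ, ∀ f g : Fin n → R, ∑ i, a i * f i ^ 2 = π * ∑ i, a i * g i ^ 2 →
      (∀ i, π ^ k ∣ f i) ∧ ∀ i, π ^ k ∣ g i := by
    intro k
    induction k with
    | zero => intro f g _; simp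
    | succ k ih =>
      intro f g e
      obtain ⟨f', hf, e1⟩ := step f g e
      obtain ⟨g', hg, e2⟩ := step g f' e1
      obtain ⟨h1, h2⟩ := ih f' g' e2
      refine ⟨fun i => ?_, fun i => ?_⟩
      · rw [hf, pow_succ']; exact mul_dvd_mul_left _ (h1 i)
      · rw [hg, pow_succ']; exact mul_dvd_mul_left _ (h2 i)
  have inf : ∀ r : R, (∀ k, π ^ k ∣ r) → r = 0 := by
    intro r hr
    by_contra h0
    obtain ⟨k, hk⟩ := FiniteMultiplicity.of_not_isUnit hu h0
    exact hk (hr _)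
  exact ⟨fun i => inf _ fun k => (key k f g e).1 i, fun i => inf _ fun k => (key k f g e).2 i⟩

theorem pf_descent_frac {n : ℕ} {R K : Type*} [CommRing R] [IsDomain R] [WfDvdMonoid R]
    [Field K] [Algebra R K] [IsFractionRing R K]
    (π : R) (hπ : π ≠ 0) (hu : ¬ IsUnit π) (a : Fin n → R)
    (h : ∀ x : Fin n → R, π ∣ ∑ i, a i * x i ^ 2 → ∀ i, π ∣ x i)
    (f g : Fin n → K)
    (e : ∑ i, algebraMap R K (a i) * f i ^ 2
      = algebraMap R K π * ∑ i, algebraMap R K (a i) * g i ^ 2) :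
    (∀ i, f i = 0) ∧ ∀ i, g i = 0 := by
  obtain ⟨b, hb⟩ := IsLocalization.exist_integer_multiples_of_finite
    (nonZeroDivisors R) (Sum.elim f g)
  have hb0 : algebraMap R K b ≠ 0 := IsFractionRing.to_map_ne_zero_of_mem_nonZeroDivisors b.2
  choose c hc using hb
  have hf : ∀ i, algebraMap R K (c (Sum.inl i)) = algebraMap R K b * f i := fun i => by
    rw [hc, Algebra.smul_def]; rfl
  have hg : ∀ i, algebraMap R K (c (Sum.inr i)) = algebraMap R K b * g i := fun i => by
    rw [hc, Algebra.smul_def]; rfl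
  have := pf_descent π hπ hu a h (fun i => c (Sum.inl i)) (fun i => c (Sum.inr i)) (by
    apply IsFractionRing.injective R K
    simp only [map_sum, map_mul, map_pow, hf, hg]
    have e2 := congrArg (fun z => algebraMap R K b ^ 2 * z) e
    simp only [Finset.mul_sum] at e2 ⊢
    convert e2 using 2 <;> ring)
  refine ⟨fun i => ?_, fun i => ?_⟩
  · have h1 := hf i
    rw [this.1 i, map_zero] at h1
    exact (mul_eq_zero.mp h1.symm).resolve_left hb0
  · have h1 := hg i
    rw [this.2 i, map_zero] at h1
    exact (mul_eq_zero.mp h1.symm).resolve_left hb0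

theorem pf_padic (p : ℕ) [Fact p.Prime] (u : ℤ) (hu : ¬IsSquare (u : ZMod p))
    (a b c d : ℚ_[p]) (e : a ^ 2 - p * b ^ 2 - u * c ^ 2 + p * u * d ^ 2 = 0) :
    a = 0 ∧ b = 0 ∧ c = 0 ∧ d = 0 := by
  have := pf_descent_frac (R := ℤ_[p]) (K := ℚ_[p]) (p : ℤ_[p])
    PadicInt.prime_p.ne_zero PadicInt.prime_p.not_unit ![1, -u] (by
      intro x hx
      have hk : ∀ z : ℤ_[p], (p : ℤ_[p]) ∣ z ↔ PadicInt.toZMod z = 0 := by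
        intro z
        rw [← RingHom.mem_ker, PadicInt.ker_toZMod, PadicInt.maximalIdeal_eq_span_p,
          Ideal.mem_span_singleton]
      rw [hk] at hx
      simp [Fin.sum_univ_two] at hx
      have h1 : PadicInt.toZMod (x 1) = 0 := by
        by_contra h0
        apply hu
        refine ⟨PadicInt.toZMod (x 0) / PadicInt.toZMod (x 1), ?_⟩
        field_simp
        linear_combination -hx
      have h0 : PadicInt.toZMod (x 0) = 0 := by
        rw [h1] at hx; simpa using hx
      simp [Fin.forall_fin_two, hk, h0, h1]) ![a, c] ![b, d] (by
      simp [Fin.sum_univ_two]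
      linear_combination e)
  simp [Fin.forall_fin_two] at this
  tauto


/-- If `p` is an odd prime and `u` an integer not divisible by `p` whose residue class is
not a square mod `p`, then the 3-fold Pfister form `⟨⟨p,u,t⟩⟩` is anisotropic over the
rational function field `ℚ_p(t)`. -/
theorem pfister3_p_u_t_anisotropic_over_padic_ratfunc
    (p : ℕ) [Fact p.Prime] (hp : p ≠ 2) (u : ℤ) (hpu : ¬(p : ℤ) ∣ u)
    (hu : ¬IsSquare (u : ZMod p)) :
    ∀ x₁ x₂ x₃ x₄ x₅ x₆ x₇ x₈ : RatFunc ℚ_[p],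
      x₁ ^ 2 - (p : RatFunc ℚ_[p]) * x₂ ^ 2 - (u : RatFunc ℚ_[p]) * x₃ ^ 2
        + (p : RatFunc ℚ_[p]) * (u : RatFunc ℚ_[p]) * x₄ ^ 2
        - RatFunc.X * x₅ ^ 2 + (p : RatFunc ℚ_[p]) * RatFunc.X * x₆ ^ 2
        + (u : RatFunc ℚ_[p]) * RatFunc.X * x₇ ^ 2
        - (p : RatFunc ℚ_[p]) * (u : RatFunc ℚ_[p]) * RatFunc.X * x₈ ^ 2 = 0 →
      x₁ = 0 ∧ x₂ = 0 ∧ x₃ = 0 ∧ x₄ = 0 ∧ x₅ = 0 ∧ x₆ = 0 ∧ x₇ = 0 ∧ x₈ = 0 := by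
  intro x₁ x₂ x₃ x₄ x₅ x₆ x₇ x₈ e
  have := pf_descent_frac (R := Polynomial ℚ_[p]) (K := RatFunc ℚ_[p]) Polynomial.X
    Polynomial.X_ne_zero Polynomial.not_isUnit_X ![1, -p, -u, p * u] (by
      intro x hx
      rw [Polynomial.X_dvd_iff, Polynomial.coeff_zero_eq_eval_zero] at hx
      simp [Fin.sum_univ_four] at hx
      have := pf_padic p u hu _ _ _ _ (by linear_combination hx :
        (x 0).eval 0 ^ 2 - p * (x 1).eval 0 ^ 2 - u * (x 2).eval 0 ^ 2
          + p * u * (x 3).eval 0 ^ 2 = 0)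
      intro i
      rw [Polynomial.X_dvd_iff, Polynomial.coeff_zero_eq_eval_zero]
      fin_cases i <;> simp [this]) ![x₁, x₂, x₃, x₄] ![x₅, x₆, x₇, x₈] (by
      simp [Fin.sum_univ_four]
      linear_combination e)
  obtain ⟨h1, h2⟩ := this
  exact ⟨h1 0, h1 1, h1 2, h1 3, h2 0, h2 1, h2 2, h2 3⟩
end
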